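/- Let v = (e¹∧e⁴−e²∧e³)+(e⁵∧e²−e⁶∧e¹)+(e³∧e⁶−e⁴∧e⁵). Then v∧v∧(e¹∧e⁴−e²∧e³) = v∧v∧(e⁵∧e²−e⁶∧e¹) = v∧v∧(e³∧e⁶−e⁴∧e⁵) = 4 vol₆, while v∧v∧α = 0 for each α ∈ {e¹∧e²−e³∧e⁴, e¹∧e²+e³∧e⁴−2e⁵∧e⁶, e¹∧e³+e²∧e⁴, e⁵∧e¹+e⁶∧e², e³∧e⁵+e⁴∧e⁶}. Equivalently, v∧v∧α = 2⟨v,α⟩ vol₆ for every α in the span of these eight 2-forms. (Under the identification of 𝔰𝔲(3) with primitive (1,1)-forms used in Section 4, this states Q₀(v,v) = 2v for the quadratic map Q₀(η,η) = *π₈(η∧η), where v is the image of e₂+e₄+e₆ ∈ 𝔰𝔲(3); this is the key computation of Lemma 4.1.) -/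

import Mathlib

open scoped TensorProduct

noncomputable section

/-- ℝ⁶ with standard basis indexed by `Fin 6` (index `i` corresponds to eᵢ₊₁). -/
abbrev V6 : Type := Fin 6 → ℝ

/-- Alternating `k`-forms on ℝ⁶. -/
abbrev Form (k : ℕ) : Type := V6 [⋀^Fin k]→ₗ[ℝ] ℝ

/-- Wedge product of alternating forms (determinant convention). -/
def wedge {p q : ℕ} (α : Form p) (β : Form q) : Form (p + q) :=
  (((TensorProduct.lid ℝ ℝ).toLinearMap).compAlternatingMap
    (α.domCoprod β)).domDomCongr finSumFinEquiv

/-- The standard basis vectors of ℝ⁶ (`E 0` is e₁, …, `E 5` is e₆). -/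
def E (i : Fin 6) : V6 := Pi.single i 1

/-- The dual basis 1-forms (`ec 0` is e¹, …, `ec 5` is e⁶). -/
def ec (i : Fin 6) : Form 1 := AlternatingMap.ofSubsingleton ℝ V6 ℝ 0 (LinearMap.proj i)

/-- The dual basis 1-forms e¹, …, e⁶. -/
def d1 : Form 1 := ec 0
def d2 : Form 1 := ec 1
def d3 : Form 1 := ec 2
def d4 : Form 1 := ec 3
def d5 : Form 1 := ec 4
def d6 : Form 1 := ec 5

/-- ω = e¹∧e² + e³∧e⁴ + e⁵∧e⁶. -/
def ω : Form 2 := wedge d1 d2 + wedge d3 d4 + wedge d5 d6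

/-- Re Ω = e²∧e⁴∧e⁶ − e¹∧e³∧e⁶ − e²∧e³∧e⁵ − e¹∧e⁴∧e⁵. -/
def ReΩ : Form 3 :=
  wedge d2 (wedge d4 d6) - wedge d1 (wedge d3 d6)
    - wedge d2 (wedge d3 d5) - wedge d1 (wedge d4 d5)

/-- Im Ω = e¹∧e³∧e⁵ − e²∧e⁴∧e⁵ − e¹∧e⁴∧e⁶ − e²∧e³∧e⁶. -/
def ImΩ : Form 3 :=
  wedge d1 (wedge d3 d5) - wedge d2 (wedge d4 d5)
    - wedge d1 (wedge d4 d6) - wedge d2 (wedge d3 d6)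

/-- The volume form vol₆ = e¹∧e²∧e³∧e⁴∧e⁵∧e⁶. -/
def vol6 : Form 6 := wedge d1 (wedge d2 (wedge d3 (wedge d4 (wedge d5 d6))))

/-- The inner product on 2-forms making the eⁱ∧eʲ (i<j) orthonormal. -/
def inner2 (α β : Form 2) : ℝ := (1/2) * ∑ i, ∑ j, α ![E i, E j] * β ![E i, E j]

/-- The inner product on 1-forms making the eⁱ orthonormal. -/
def inner1 (α β : Form 1) : ℝ := ∑ i, α ![E i] * β ![E i]

/-- v = (e¹∧e⁴−e²∧e³) + (e⁵∧e²−e⁶∧e¹) + (e³∧e⁶−e⁴∧e⁵). -/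
def v : Form 2 :=
  (wedge d1 d4 - wedge d2 d3) + (wedge d5 d2 - wedge d6 d1) + (wedge d3 d6 - wedge d4 d5)

/-- The eight 2-forms spanning Λ²₈. -/
def g8 : Fin 8 → Form 2 :=
  ![wedge d1 d2 - wedge d3 d4,
    wedge d1 d2 + wedge d3 d4 - (2:ℝ) • wedge d5 d6,
    wedge d1 d3 + wedge d2 d4,
    wedge d1 d4 - wedge d2 d3,
    wedge d5 d1 + wedge d6 d2,
    wedge d5 d2 - wedge d6 d1,
    wedge d3 d5 + wedge d4 d6,
    wedge d3 d6 - wedge d4 d5]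

/-- The wedge product as a bilinear map. -/
def wedgeₗ (p q : ℕ) : Form p →ₗ[ℝ] Form q →ₗ[ℝ] Form (p + q) :=
  LinearMap.mk₂ ℝ wedge
    (fun α α' β => by
      ext x
      simp [wedge, ← AlternatingMap.domCoprod'_apply, TensorProduct.add_tmul])
    (fun c α β => by
      ext x
      simp [wedge, ← AlternatingMap.domCoprod'_apply, ← TensorProduct.smul_tmul'])
    (fun α β β' => by
      ext x
      simp [wedge, ← AlternatingMap.domCoprod'_apply, TensorProduct.tmul_add])
    (fun c α β => by
      ext x
      simp [wedge, ← AlternatingMap.domCoprod'_apply, TensorProduct.tmul_smul])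

theorem wedgeₗ_apply {p q : ℕ} (α : Form p) (β : Form q) : wedgeₗ p q α β = wedge α β := rfl

/-- The multilinear map `x ↦ ∏ i, x i (s i)`. -/
def coordMonomial {ι : Type*} [Fintype ι] (s : ι → Fin 6) :
    MultilinearMap ℝ (fun _ : ι => V6) ℝ :=
  (MultilinearMap.mkPiAlgebra ℝ ι ℝ).compLinearMap fun i => LinearMap.proj (s i)

/-- The form `e^{s 0} ∧ ⋯ ∧ e^{s (k-1)}`. -/
def basisForm {k : ℕ} (s : Fin k → Fin 6) : Form k :=
  MultilinearMap.alternatization (coordMonomial s)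

theorem basisForm_apply {k : ℕ} (s : Fin k → Fin 6) (x : Fin k → V6) :
    basisForm s x = Matrix.det (Matrix.of fun i j => x i (s j)) := by
  simp [basisForm, coordMonomial, MultilinearMap.alternatization_apply, Matrix.det_apply]

theorem wedge_basisForm {p q : ℕ} (s : Fin p → Fin 6) (t : Fin q → Fin 6) :
    wedge (basisForm s) (basisForm t) = basisForm (Fin.append s t) := by
  have key : (TensorProduct.lid ℝ ℝ).toLinearMap.compMultilinearMap
      ((coordMonomial s).domCoprod (coordMonomial t)) = coordMonomial (Sum.elim s t) := by
    ext x
    simp [coordMonomial]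
  have reindex : coordMonomial (Fin.append s t) =
      (coordMonomial (Sum.elim s t)).domDomCongr finSumFinEquiv := by
    ext x
    simp [coordMonomial, Fin.prod_univ_add]
  rw [wedge, basisForm, basisForm, ← MultilinearMap.domCoprod_alternization,
    ← LinearMap.compMultilinearMap_alternatization, key, basisForm, reindex]
  ext x
  simp only [AlternatingMap.domDomCongr_apply, MultilinearMap.alternatization_apply,
    MultilinearMap.domDomCongr_apply]
  refine Fintype.sum_equiv (Equiv.permCongr finSumFinEquiv) _ _ fun σ => ?_
  simp [Equiv.Perm.sign_permCongr]

theorem ec_eq_basisForm (i : Fin 6) : ec i = basisForm ![i] := by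
  ext x
  simp [ec, basisForm_apply]

theorem wedge_ec (i j : Fin 6) : wedge (ec i) (ec j) = basisForm ![i, j] := by
  rw [ec_eq_basisForm, ec_eq_basisForm, wedge_basisForm]
  congr 1
  ext k
  fin_cases k <;> rfl

theorem vol6_eq_basisForm : vol6 = basisForm id := by
  simp only [vol6, d1, d2, d3, d4, d5, d6, ec_eq_basisForm, wedge_basisForm]
  refine congrArg (basisForm (k := 6)) ?_
  ext k
  fin_cases k <;> rfl

/-- The sign of the rearrangement of `s` in increasing order, or `0` if `s` has a repetition. -/
def indexSign {n k : ℕ} (s : Fin k → Fin n) : ℤ :=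
  ∏ j, ∏ i ∈ Finset.Iio j, if s i < s j then 1 else if s i = s j then 0 else -1

theorem indexSign_perm {n : ℕ} (σ : Equiv.Perm (Fin n)) : indexSign σ = Equiv.Perm.sign σ := by
  rw [indexSign, Equiv.Perm.sign_eq_prod_prod_Iio]
  push_cast
  refine Finset.prod_congr rfl fun j _ => Finset.prod_congr rfl fun i hi => ?_
  have hij : i ≠ j := (Finset.mem_Iio.1 hi).ne
  simp [hij]
  split_ifs <;> simp

theorem indexSign_eq_zero {n k : ℕ} {s : Fin k → Fin n} (hs : ¬ Function.Injective s) :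
    indexSign s = 0 := by
  obtain ⟨i, j, hij, hlt⟩ : ∃ i j, s i = s j ∧ i < j := by
    simp only [Function.Injective, not_forall] at hs
    obtain ⟨i, j, h, hne⟩ := hs
    rcases lt_or_gt_of_ne hne with hlt | hlt
    exacts [⟨i, j, h, hlt⟩, ⟨j, i, h.symm, hlt⟩]
  exact Finset.prod_eq_zero (Finset.mem_univ j)
    (Finset.prod_eq_zero (Finset.mem_Iio.2 hlt) (by simp [hij]))

theorem basisForm_eq_indexSign_smul (s : Fin 6 → Fin 6) : basisForm s = indexSign s • vol6 := by
  ext x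
  rw [vol6_eq_basisForm, AlternatingMap.smul_apply, basisForm_apply, basisForm_apply]
  by_cases hs : Function.Injective s
  · obtain ⟨σ, rfl⟩ : ∃ σ : Equiv.Perm (Fin 6), ⇑σ = s :=
      ⟨Equiv.ofBijective s (Finite.injective_iff_bijective.1 hs), rfl⟩
    rw [indexSign_perm, zsmul_eq_mul]
    exact Matrix.det_permute' σ (Matrix.of fun i j => x i j)
  · rw [indexSign_eq_zero hs, zero_smul]
    simp only [Function.Injective, not_forall] at hs
    obtain ⟨i, j, h, hne⟩ := hs
    exact Matrix.det_zero_of_column_eq hne fun k => by simp [h]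

/-- The integral 2-form `∑ i, c i • e^{s i 0} ∧ e^{s i 1}`. -/
def twoForm {n : ℕ} (c : Fin n → ℤ) (s : Fin n → Fin 2 → Fin 6) : Form 2 :=
  ∑ i, c i • basisForm (s i)

theorem wedge_twoForm {l m n : ℕ} (c : Fin l → ℤ) (s : Fin l → Fin 2 → Fin 6)
    (d : Fin m → ℤ) (t : Fin m → Fin 2 → Fin 6) (e : Fin n → ℤ) (u : Fin n → Fin 2 → Fin 6) :
    wedge (wedge (twoForm c s) (twoForm d t)) (twoForm e u) =
      (∑ i, ∑ j, ∑ k, c i * d j * e k *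
        indexSign (Fin.append (Fin.append (s i) (t j)) (u k))) • vol6 := by
  simp only [← wedgeₗ_apply, twoForm, map_sum, LinearMap.sum_apply, map_zsmul,
    LinearMap.smul_apply, Finset.sum_smul, Finset.smul_sum]
  simp only [wedgeₗ_apply, wedge_basisForm, mul_smul]
  refine Finset.sum_comm.trans ((Finset.sum_congr rfl fun j _ => Finset.sum_comm).trans
    (Finset.sum_comm.trans ?_))
  refine Finset.sum_congr rfl fun i _ => Finset.sum_congr rfl fun j _ =>
    Finset.sum_congr rfl fun k _ => ?_
  rw [← basisForm_eq_indexSign_smul, smul_comm (e k), smul_comm (e k), smul_comm (d j)]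

theorem twoForm_apply {n : ℕ} (c : Fin n → ℤ) (s : Fin n → Fin 2 → Fin 6) (x : Fin 2 → V6) :
    twoForm c s x = ∑ k, c k • basisForm (s k) x := by
  let evalHom : Form 2 →+ ℝ := { toFun := fun α => α x, map_zero' := rfl, map_add' _ _ := rfl }
  exact map_sum evalHom _ _

theorem twoForm_apply_E {n : ℕ} (c : Fin n → ℤ) (s : Fin n → Fin 2 → Fin 6) (i j : Fin 6) :
    twoForm c s ![E i, E j] = ((∑ k, c k *
      ((if s k 1 = j ∧ s k 0 = i then 1 else 0) -
        if s k 0 = j ∧ s k 1 = i then 1 else 0) : ℤ) : ℝ) := by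
  simp [twoForm_apply, basisForm_apply, Matrix.det_fin_two, E, Pi.single_apply,
    ite_and]

/-- `inner2 α` as a linear functional. -/
def inner2ₗ (α : Form 2) : Form 2 →ₗ[ℝ] ℝ where
  toFun := inner2 α
  map_add' β γ := by simp [inner2, mul_add, Finset.sum_add_distrib]
  map_smul' c β := by
    simp only [inner2, AlternatingMap.smul_apply, smul_eq_mul, RingHom.id_apply, Finset.mul_sum]
    refine Finset.sum_congr rfl fun i _ => Finset.sum_congr rfl fun j _ => ?_
    ring

theorem inner2ₗ_apply (α β : Form 2) : inner2ₗ α β = inner2 α β := rfl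

/-- The coefficients of the monomials of `v` indexed by `vIndex`. -/
def vCoeff : Fin 6 → ℤ := ![1, -1, 1, -1, 1, -1]

/-- The indices of the monomials of `v`. -/
def vIndex : Fin 6 → Fin 2 → Fin 6 := ![![0, 3], ![1, 2], ![4, 1], ![5, 0], ![2, 5], ![3, 4]]

theorem v_eq_twoForm : v = twoForm vCoeff vIndex := by
  simp [v, twoForm, vCoeff, vIndex, Fin.sum_univ_succ, d1, d2, d3, d4, d5, d6, wedge_ec]
  abel

/-- The coefficients of the monomials of `g8 i` indexed by `g8Index i`. -/
def g8Coeff : Fin 8 → Fin 3 → ℤ :=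
  ![![1, -1, 0], ![1, 1, -2], ![1, 1, 0], ![1, -1, 0], ![1, 1, 0], ![1, -1, 0], ![1, 1, 0],
    ![1, -1, 0]]

/-- The indices of the monomials of `g8 i`, padded to three each. -/
def g8Index : Fin 8 → Fin 3 → Fin 2 → Fin 6 :=
  ![![![0, 1], ![2, 3], ![4, 5]], ![![0, 1], ![2, 3], ![4, 5]], ![![0, 2], ![1, 3], ![4, 5]],
    ![![0, 3], ![1, 2], ![4, 5]], ![![4, 0], ![5, 1], ![2, 3]], ![![4, 1], ![5, 0], ![2, 3]],
    ![![2, 4], ![3, 5], ![0, 1]], ![![2, 5], ![3, 4], ![0, 1]]]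

theorem g8_eq_twoForm (i : Fin 8) : g8 i = twoForm (g8Coeff i) (g8Index i) := by
  have two_smul_form (α : Form 2) : (2 : ℤ) • α = (2 : ℝ) • α := by
    rw [two_smul, two_smul]
  fin_cases i <;>
    simp [g8, twoForm, g8Coeff, g8Index, Fin.sum_univ_succ, d1, d2, d3, d4, d5, d6, wedge_ec,
      sub_eq_add_neg, add_assoc, two_smul_form]

/-- The inner products of `v` with the forms `g8 i`. -/
def vInner : Fin 8 → ℤ := ![0, 0, 0, 2, 0, 2, 0, 2]

theorem inner2_v_g8 (i : Fin 8) : inner2 v (g8 i) = vInner i := by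
  simp only [v_eq_twoForm, g8_eq_twoForm, inner2, twoForm_apply_E, ← Int.cast_mul, ← Int.cast_sum]
  rw [div_mul_eq_mul_div, one_mul, div_eq_iff two_ne_zero]
  norm_cast
  revert i
  decide +kernel

theorem wedge_v_v_g8 (i : Fin 8) : wedge (wedge v v) (g8 i) = (2 * vInner i) • vol6 := by
  rw [v_eq_twoForm, g8_eq_twoForm, wedge_twoForm]
  congr 1
  revert i
  decide +kernel

/-- With v as above: v∧v∧(e¹∧e⁴−e²∧e³) = v∧v∧(e⁵∧e²−e⁶∧e¹)
= v∧v∧(e³∧e⁶−e⁴∧e⁵) = 4 vol₆, while v∧v∧α = 0 for the other five basic forms of Λ²₈;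
equivalently v∧v∧α = 2⟨v,α⟩ vol₆ for every α in the span of the eight forms.
(This is Q₀(v,v) = 2v, the key computation of Lemma 4.1.) -/
theorem obstruction_quadratic_term :
    wedge (wedge v v) (wedge d1 d4 - wedge d2 d3) = (4:ℝ) • vol6 ∧
    wedge (wedge v v) (wedge d5 d2 - wedge d6 d1) = (4:ℝ) • vol6 ∧
    wedge (wedge v v) (wedge d3 d6 - wedge d4 d5) = (4:ℝ) • vol6 ∧
    wedge (wedge v v) (wedge d1 d2 - wedge d3 d4) = 0 ∧
    wedge (wedge v v) (wedge d1 d2 + wedge d3 d4 - (2:ℝ) • wedge d5 d6) = 0 ∧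
    wedge (wedge v v) (wedge d1 d3 + wedge d2 d4) = 0 ∧
    wedge (wedge v v) (wedge d5 d1 + wedge d6 d2) = 0 ∧
    wedge (wedge v v) (wedge d3 d5 + wedge d4 d6) = 0 ∧
    (∀ α ∈ Submodule.span ℝ (Set.range g8),
      wedge (wedge v v) α = (2 * inner2 v α) • vol6) := by
  have hbasis (i : Fin 8) (m : ℤ) (hm : 2 * vInner i = m) :
      wedge (wedge v v) (g8 i) = (m : ℝ) • vol6 := by
    rw [wedge_v_v_g8, hm]
    exact (Int.cast_smul_eq_zsmul ℝ m vol6).symm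
  have hspan : ∀ α ∈ Submodule.span ℝ (Set.range g8),
      wedge (wedge v v) α = (2 * inner2 v α) • vol6 := by
    intro α hα
    induction hα using Submodule.span_induction with
    | mem _ h =>
      obtain ⟨i, rfl⟩ := h
      rw [hbasis i _ rfl, inner2_v_g8]
      push_cast
      rfl
    | zero => simp [← wedgeₗ_apply, ← inner2ₗ_apply]
    | add α β _ _ hα hβ =>
      simp only [← wedgeₗ_apply, ← inner2ₗ_apply, map_add] at hα hβ ⊢
      rw [hα, hβ, ← add_smul, mul_add]
    | smul c α _ hα =>
      simp only [← wedgeₗ_apply, ← inner2ₗ_apply, map_smul] at hα ⊢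
      rw [hα, smul_smul, smul_eq_mul, mul_left_comm]
  refine ⟨(hbasis 3 4 rfl).trans ?_, (hbasis 5 4 rfl).trans ?_, (hbasis 7 4 rfl).trans ?_,
    (hbasis 0 0 rfl).trans ?_, (hbasis 1 0 rfl).trans ?_, (hbasis 2 0 rfl).trans ?_,
    (hbasis 4 0 rfl).trans ?_, (hbasis 6 0 rfl).trans ?_, hspan⟩ <;>
  norm_num
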